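/- There exists a strictly increasing function τ : ℝ_{>0} → ℝ_{>0}, depending only on p_3,…,p_n, q_3,…,q_n, with the following property: for every A > 0 and all nonzero integers α, β with αβ > 0 and Δ ≠ 0 (and p_iα − q_iβ ∈ ℤ for all i), the limit lim_{x→0⁺} y^A_{α,β}(x) / x^{τ(α/β)} exists and is a positive finite real number. -/

import Mathlib

open scoped BigOperators
noncomputable section
namespace LamSec

variable {ι : Type*} [Fintype ι]

/-- `D` is the least common denominator of the (nonzero) `p i` and `q i`:
`D > 0`, `D` clears all denominators, and `D` divides any other positive
integer clearing all denominators. -/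
def IsLCD (p q : ι → ℚ) (D : ℕ) : Prop :=
  0 < D ∧ (∀ i, (p i * (D : ℚ)).den = 1 ∧ (q i * (D : ℚ)).den = 1) ∧
    ∀ D' : ℕ, 0 < D' →
      (∀ i, (p i * (D' : ℚ)).den = 1 ∧ (q i * (D' : ℚ)).den = 1) → D ∣ D'

/-- The function `Λ^A_{α,β}(x,y)`, where `e i` is the integer `p i * α - q i * β`. -/
def Lam (p q : ι → ℚ) (e : ι → ℤ) (A : ℝ) (D : ℕ) (α β : ℤ) (x y : ℝ) : ℝ :=
  x ^ α * y ^ (-β) * ∏ i, ((p i : ℝ) * x + (q i : ℝ) * y) ^ (e i) - A ^ D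

/-- `Δ = (1 + Σ p_i) α − (1 + Σ q_i) β`. -/
def Del (p q : ι → ℚ) (α β : ℤ) : ℚ :=
  (1 + ∑ i, p i) * (α : ℚ) - (1 + ∑ i, q i) * (β : ℚ)

open Filter Topology in
theorem core_asymp (l : Filter ℝ) (g t : ℝ → ℝ) (c k r δ M : ℝ) (hr : 0 < r) (hM : 0 < M)
    (hg : Tendsto g l (𝓝 c)) (ht : Tendsto t (𝓝[>] 0) l)
    (htp : ∀ x, 0 < x → x < M → 0 < t x)
    (heq : ∀ x, 0 < x → x < M → -r * Real.log (t x) + g (t x) = k - δ * Real.log x) :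
    Tendsto (fun x => t x / x ^ (δ / r)) (𝓝[>] 0) (𝓝 (Real.exp ((c - k) / r))) := by
  have h1 : Tendsto (fun x => Real.exp ((g (t x) - k) / r)) (𝓝[>] 0)
      (𝓝 (Real.exp ((c - k) / r))) := by
    apply (Real.continuous_exp.tendsto _).comp
    exact ((hg.comp ht).sub_const k).div_const r
  refine h1.congr' ?_
  filter_upwards [Ioo_mem_nhdsGT hM] with x hx
  have hx0 := hx.1
  have h := heq x hx.1 hx.2
  have htx := htp x hx.1 hx.2
  have : (g (t x) - k) / r = Real.log (t x) - Real.log x * (δ / r) := by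
    field_simp
    linarith
  rw [this, Real.exp_sub, Real.exp_log htx, Real.rpow_def_of_pos hx0]

open Filter Topology in
theorem root_to_zero (L t : ℝ → ℝ) (k δ M : ℝ) (hM : 0 < M) (hδ : 0 < δ)
    (hc : ContinuousOn L (Set.Ioi 0)) (hL : Tendsto L (𝓝[>] 0) atTop)
    (htp : ∀ x, 0 < x → x < M → 0 < t x)
    (hu : ∀ x, 0 < x → x < M → ∀ s, 0 < s → L s = k - δ * Real.log x → s = t x) :
    Tendsto t (𝓝[>] 0) (𝓝[>] 0) := by
  have hv : Tendsto (fun x => k - δ * Real.log x) (𝓝[>] 0) atTop := by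
    have h1 := (Real.tendsto_log_nhdsGT_zero.const_mul_atBot hδ)
    have h2 := tendsto_atTop_add_const_left _ k (tendsto_neg_atBot_atTop.comp h1)
    exact h2.congr (fun x => by simp [sub_eq_add_neg])
  rw [(nhdsGT_basis (0:ℝ)).tendsto_right_iff]
  intro ε hε
  filter_upwards [Ioo_mem_nhdsGT hM, hv.eventually_gt_atTop (L (ε/2))] with x hx hx2
  obtain ⟨s, hs1, hs2⟩ := ((hL.eventually_gt_atTop (k - δ * Real.log x)).and
    (Ioo_mem_nhdsGT (half_pos hε))).exists
  have hsub : Set.Icc s (ε/2) ⊆ Set.Ioi 0 := fun z hz => lt_of_lt_of_le hs2.1 hz.1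
  obtain ⟨z, hz, hz2⟩ := intermediate_value_Icc' hs2.2.le (hc.mono hsub)
    (show k - δ * Real.log x ∈ Set.Icc (L (ε/2)) (L s) from ⟨hx2.le, hs1.le⟩)
  have := hu x hx.1 hx.2 z (hsub hz) hz2
  rw [← this]
  exact ⟨hsub hz, by linarith [hz.2]⟩

open Filter Topology in
theorem root_to_top (L t : ℝ → ℝ) (k δ M : ℝ) (hM : 0 < M) (hδ : δ < 0)
    (hc : ContinuousOn L (Set.Ioi 0)) (hL : Tendsto L atTop atBot)
    (hu : ∀ x, 0 < x → x < M → ∀ s, 0 < s → L s = k - δ * Real.log x → s = t x) :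
    Tendsto t (𝓝[>] 0) atTop := by
  have hv : Tendsto (fun x => k - δ * Real.log x) (𝓝[>] 0) atBot := by
    have h1 := (Real.tendsto_log_nhdsGT_zero.const_mul_atBot (neg_pos.2 hδ))
    have h2 := tendsto_atBot_add_const_left _ k h1
    exact h2.congr (fun x => by ring)
  rw [tendsto_atTop]
  intro N0
  set N := max N0 1 with hN
  have hN1 : 0 < N := lt_of_lt_of_le one_pos (le_max_right _ _)
  filter_upwards [Ioo_mem_nhdsGT hM, hv.eventually_lt_atBot (L N)] with x hx hx2
  obtain ⟨s, hs1, hs2⟩ := ((hL.eventually_lt_atBot (k - δ * Real.log x)).and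
    (eventually_gt_atTop N)).exists
  have hsub : Set.Icc N s ⊆ Set.Ioi 0 := fun z hz => lt_of_lt_of_le hN1 hz.1
  obtain ⟨z, hz, hz2⟩ := intermediate_value_Icc' hs2.le (hc.mono hsub)
    (show k - δ * Real.log x ∈ Set.Icc (L s) (L N) from ⟨hs1.le, hx2.le⟩)
  have := hu x hx.1 hx.2 z (hsub hz) hz2
  rw [← this]
  exact (le_max_left _ _).trans hz.1

/-- logarithm of the homogeneous profile -/
def LL {ι : Type} [Fintype ι] (a b : ι → ℝ) (σ s : ℝ) : ℝ :=
  -Real.log s + ∑ i, (a i * σ - b i) * Real.log (a i + b i * s)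

theorem base_pos {a b s : ℝ} (h : 0 ≤ a ∧ 0 ≤ b ∧ ¬(a = 0 ∧ b = 0)) (hs : 0 < s) :
    0 < a + b * s := by
  obtain ⟨h1, h2, h3⟩ := h
  rcases h1.eq_or_lt with h | h
  · have : 0 < b := lt_of_le_of_ne h2 (fun hb => h3 ⟨h.symm, hb.symm⟩)
    positivity
  · positivity

theorem LL_cont {ι : Type} [Fintype ι] (a b : ι → ℝ) (σ : ℝ)
    (h : ∀ i, 0 ≤ a i ∧ 0 ≤ b i ∧ ¬(a i = 0 ∧ b i = 0)) :
    ContinuousOn (LL a b σ) (Set.Ioi 0) := by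
  unfold LL
  apply ContinuousOn.add
  · exact (Real.continuousOn_log.mono (fun x hx => ne_of_gt hx)).neg
  · refine continuousOn_finset_sum _ (fun i _ => continuousOn_const.mul ?_)
    apply ContinuousOn.log (by fun_prop)
    intro x hx
    exact (base_pos (h i) hx).ne'

open Filter Topology in
theorem LL_zero {ι : Type} [Fintype ι] (a b : ι → ℝ) (σ : ℝ)
    (h : ∀ i, 0 ≤ a i ∧ 0 ≤ b i ∧ ¬(a i = 0 ∧ b i = 0)) :
    ∃ (g : ℝ → ℝ) (c : ℝ), Tendsto g (𝓝[>] 0) (𝓝 c) ∧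
      ∀ s, 0 < s → LL a b σ s = -(1 + ∑ i, if a i = 0 then b i else 0) * Real.log s + g s := by
  refine ⟨fun s => ∑ i, if a i = 0 then -b i * Real.log (b i) else
    (a i * σ - b i) * Real.log (a i + b i * s), ∑ i, if a i = 0 then -b i * Real.log (b i) else
    (a i * σ - b i) * Real.log (a i + b i * 0), ?_, ?_⟩
  · refine tendsto_finset_sum _ (fun i _ => ?_)
    split_ifs with hi
    · exact tendsto_const_nhds
    · apply Tendsto.mono_left _ nhdsWithin_le_nhds
      apply Tendsto.const_mul
      apply Tendsto.log
      · exact Continuous.tendsto (by fun_prop) 0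
      · simpa using hi
  · intro s hs
    have : ∀ i, (a i * σ - b i) * Real.log (a i + b i * s) =
        -(if a i = 0 then b i else 0) * Real.log s + (if a i = 0 then -b i * Real.log (b i) else
    (a i * σ - b i) * Real.log (a i + b i * s)) := by
      intro i
      split_ifs with hi
      · have hb : b i ≠ 0 := fun hb => (h i).2.2 ⟨hi, hb⟩
        rw [hi, zero_add, Real.log_mul hb hs.ne']
        ring
      · ring
    unfold LL
    rw [Finset.sum_congr rfl (fun i _ => this i), Finset.sum_add_distrib, ← Finset.sum_mul,
      Finset.sum_neg_distrib]
    ring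

open Filter Topology in
theorem LL_top {ι : Type} [Fintype ι] (a b : ι → ℝ) (σ : ℝ)
    (h : ∀ i, 0 ≤ a i ∧ 0 ≤ b i ∧ ¬(a i = 0 ∧ b i = 0)) :
    ∃ (g : ℝ → ℝ) (c : ℝ), Tendsto g atTop (𝓝 c) ∧
      ∀ s, 0 < s → LL a b σ s =
        -(1 + ∑ i, b i - (∑ i, if b i = 0 then 0 else a i) * σ) * Real.log s + g s := by
  refine ⟨fun s => ∑ i, if b i = 0 then a i * σ * Real.log (a i) else
    (a i * σ - b i) * Real.log (a i * s⁻¹ + b i),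
    ∑ i, if b i = 0 then a i * σ * Real.log (a i) else
    (a i * σ - b i) * Real.log (a i * 0 + b i), ?_, ?_⟩
  · refine tendsto_finset_sum _ (fun i _ => ?_)
    split_ifs with hi
    · exact tendsto_const_nhds
    · apply Tendsto.const_mul
      apply Tendsto.log
      · exact (tendsto_inv_atTop_zero.const_mul _).add_const _
      · simpa using hi
  · intro s hs
    have : ∀ i, (a i * σ - b i) * Real.log (a i + b i * s) =
        (((if b i = 0 then 0 else a i) * σ) - b i) * Real.log s +
        (if b i = 0 then a i * σ * Real.log (a i) else
          (a i * σ - b i) * Real.log (a i * s⁻¹ + b i)) := by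
      intro i
      split_ifs with hi
      · rw [hi]; simp
      · have hb : 0 < b i := lt_of_le_of_ne (h i).2.1 (Ne.symm hi)
        have ha := (h i).1
        have e1 : a i + b i * s = s * (a i * s⁻¹ + b i) := by field_simp
        rw [e1, Real.log_mul hs.ne' (by positivity)]
        ring
    unfold LL
    rw [Finset.sum_congr rfl (fun i _ => this i), Finset.sum_add_distrib, ← Finset.sum_mul,
      Finset.sum_sub_distrib, ← Finset.sum_mul]
    ring

theorem Lam_iff {ι : Type} [Fintype ι] (p q : ι → ℚ)
    (hpq : ∀ i, 0 ≤ p i ∧ 0 ≤ q i ∧ ¬(p i = 0 ∧ q i = 0)) (D : ℕ) (A : ℝ) (hA : 0 < A)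
    (α β : ℤ) (hβ : β ≠ 0) (e : ι → ℤ)
    (he : ∀ i, (e i : ℚ) = p i * (α : ℚ) - q i * (β : ℚ)) (x s : ℝ) (hx : 0 < x) (hs : 0 < s) :
    Lam p q e A D α β x (x * s) = 0 ↔
      LL (fun i => (p i : ℝ)) (fun i => (q i : ℝ)) ((α : ℝ) / β) s = D * Real.log A / β -
        ((1 + ∑ i, (p i : ℝ)) * ((α : ℝ) / β) - (1 + ∑ i, (q i : ℝ))) * Real.log x := by
  have hb : ∀ i, 0 < (p i : ℝ) + q i * s := fun i =>
    base_pos ⟨by exact_mod_cast (hpq i).1, by exact_mod_cast (hpq i).2.1,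
      by exact_mod_cast (hpq i).2.2⟩ hs
  have hb2 : ∀ i, (p i : ℝ) * x + q i * (x * s) = x * (p i + q i * s) := fun i => by ring
  have hβ' : (β : ℝ) ≠ 0 := by exact_mod_cast hβ
  have heR : ∀ i, (e i : ℝ) = β * (p i * ((α : ℝ) / β) - q i) := by
    intro i
    have : (e i : ℝ) = p i * α - q i * β := by exact_mod_cast he i
    rw [this]
    field_simp
  unfold Lam
  rw [sub_eq_zero]
  simp only [hb2]
  have hpr : 0 < ∏ i, (x * ((p i : ℝ) + q i * s)) ^ (e i) :=
    Finset.prod_pos (fun i _ => zpow_pos (mul_pos hx (hb i)) _)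
  have hW : 0 < x ^ α * (x * s) ^ (-β) * ∏ i, (x * ((p i : ℝ) + q i * s)) ^ (e i) := by
    positivity
  have hlog : Real.log (x ^ α * (x * s) ^ (-β) * ∏ i, (x * ((p i : ℝ) + q i * s)) ^ (e i)) =
      β * (((1 + ∑ i, (p i : ℝ)) * ((α : ℝ) / β) - (1 + ∑ i, (q i : ℝ))) * Real.log x +
      LL (fun i => (p i : ℝ)) (fun i => (q i : ℝ)) ((α : ℝ) / β) s) := by
    rw [Real.log_mul (by positivity) hpr.ne', Real.log_mul (by positivity) (by positivity),
      Real.log_zpow, Real.log_zpow, Real.log_mul hx.ne' hs.ne',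
      Real.log_prod (fun i _ => (zpow_pos (mul_pos hx (hb i)) _).ne')]
    have : ∀ i, Real.log ((x * ((p i : ℝ) + q i * s)) ^ (e i)) =
        β * ((p i * ((α : ℝ) / β) - q i) * Real.log x +
          (p i * ((α : ℝ) / β) - q i) * Real.log (p i + q i * s)) := by
      intro i
      rw [Real.log_zpow, heR, Real.log_mul hx.ne' (hb i).ne']
      ring
    rw [Finset.sum_congr rfl (fun i _ => this i), ← Finset.mul_sum, Finset.sum_add_distrib,
      ← Finset.sum_mul, Finset.sum_sub_distrib, ← Finset.sum_mul]
    unfold LL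
    push_cast
    have hα : (α : ℝ) = β * ((α : ℝ) / β) := by field_simp
    generalize (α : ℝ) / β = σ at *
    rw [hα]
    ring
  constructor
  · intro h
    rw [h, Real.log_pow] at hlog
    rw [hlog]
    field_simp
    ring
  · intro h
    apply Real.log_injOn_pos hW (show 0 < A ^ D by positivity)
    rw [hlog, h, Real.log_pow]
    field_simp
    ring

/-- There is a strictly increasing function `τ : ℝ_{>0} → ℝ_{>0}`,
depending only on the `p i` and `q i`, such that for all admissible `A, α, β` with
`αβ > 0` and `Δ ≠ 0`, the unique positive root `y^A_{α,β}(x)` of `Λ^A_{α,β}(x,·)`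
(defined for small `x > 0`) satisfies `y^A_{α,β}(x) / x^{τ(α/β)} → C` as `x → 0⁺`
for some positive finite constant `C`. -/
theorem lam_root_power_asymptotics
    (ι : Type) [Fintype ι] (p q : ι → ℚ)
    (hpq : ∀ i, 0 ≤ p i ∧ 0 ≤ q i ∧ ¬(p i = 0 ∧ q i = 0)) :
    ∃ τ : ℝ → ℝ, StrictMonoOn τ (Set.Ioi (0:ℝ)) ∧ (∀ σ : ℝ, 0 < σ → 0 < τ σ) ∧
      ∀ (D : ℕ), IsLCD p q D →
      ∀ (A : ℝ), 0 < A →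
      ∀ (α β : ℤ), α ≠ 0 → β ≠ 0 → 0 < α * β →
      ∀ (e : ι → ℤ), (∀ i, (e i : ℚ) = p i * (α : ℚ) - q i * (β : ℚ)) →
      Del p q α β ≠ 0 →
      ∀ (M : ℝ) (yf : ℝ → ℝ), 0 < M →
        (∀ x : ℝ, 0 < x → x < M →
          0 < yf x ∧ Lam p q e A D α β x (yf x) = 0 ∧
            ∀ y : ℝ, 0 < y → Lam p q e A D α β x y = 0 → y = yf x) →
        ∃ C : ℝ, 0 < C ∧
          Filter.Tendsto (fun x : ℝ => yf x / x ^ τ ((α : ℝ) / (β : ℝ)))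
            (nhdsWithin 0 (Set.Ioi 0)) (nhds C) := by
  classical
  set a : ι → ℝ := fun i => (p i : ℝ) with ha
  set b : ι → ℝ := fun i => (q i : ℝ) with hb
  have hab : ∀ i, 0 ≤ a i ∧ 0 ≤ b i ∧ ¬(a i = 0 ∧ b i = 0) := fun i =>
    ⟨by simpa [ha] using (hpq i).1, by simpa [hb] using (hpq i).2.1,
      by simpa [ha, hb] using (hpq i).2.2⟩
  obtain ⟨P, hP⟩ : ∃ P, P = ∑ i, a i := ⟨_, rfl⟩
  obtain ⟨Q, hQ⟩ : ∃ Q, Q = ∑ i, b i := ⟨_, rfl⟩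
  obtain ⟨P', hP'⟩ : ∃ P', P' = ∑ i, if b i = 0 then 0 else a i := ⟨_, rfl⟩
  obtain ⟨Q0, hQ0⟩ : ∃ Q0, Q0 = ∑ i, if a i = 0 then b i else 0 := ⟨_, rfl⟩
  have hQn : 0 ≤ Q := hQ ▸ Finset.sum_nonneg (fun i _ => (hab i).2.1)
  have hQ0n : 0 ≤ Q0 := by
    rw [hQ0]
    refine Finset.sum_nonneg (fun i _ => ?_)
    split_ifs
    exacts [(hab i).2.1, le_rfl]
  have hP'n : 0 ≤ P' := by
    rw [hP']
    refine Finset.sum_nonneg (fun i _ => ?_)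
    split_ifs
    exacts [le_rfl, (hab i).1]
  have hP'P : P' ≤ P := by
    rw [hP', hP]
    refine Finset.sum_le_sum (fun i _ => ?_)
    split_ifs
    exacts [(hab i).1, le_rfl]
  have hr : ∀ σ : ℝ, 0 < σ → (1 + P) * σ - (1 + Q) ≤ 0 → 0 < 1 + Q - P' * σ := by
    intro σ hσ h
    have := mul_le_mul_of_nonneg_right hP'P hσ.le
    linarith
  have hτ1 : ∀ σ : ℝ, 0 < σ → (1 + P) * σ - (1 + Q) ≤ 0 →
      1 + ((1 + P) * σ - (1 + Q)) / (1 + Q - P' * σ) = (1 + P - P') * σ / (1 + Q - P' * σ) := by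
    intro σ hσ h
    have := (hr σ hσ h).ne'
    rw [eq_div_iff this, add_mul, div_mul_cancel₀ _ this]
    ring
  refine ⟨fun σ => 1 + ((1 + P) * σ - (1 + Q)) /
    (if (1 + P) * σ - (1 + Q) ≤ 0 then 1 + Q - P' * σ else 1 + Q0), ?_, ?_, ?_⟩
  · intro u hu v hv huv
    have hu0 : 0 < u := hu
    have hv0 : 0 < v := hv
    have hlt : (1 + P) * u < (1 + P) * v := mul_lt_mul_of_pos_left huv (by linarith)
    dsimp only
    split_ifs with h1 h2 h2
    · rw [hτ1 u hu0 h1, hτ1 v hv0 h2]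
      have h3 := hr v hv0 h2
      have h4 : P' * u ≤ P' * v := mul_le_mul_of_nonneg_left huv.le hP'n
      apply div_lt_div₀
      · exact mul_lt_mul_of_pos_left huv (by linarith)
      · linarith
      · exact mul_nonneg (by linarith) hv0.le
      · exact h3
    · have h3 := div_nonpos_of_nonpos_of_nonneg h1 (hr u hu0 h1).le
      have h4 : 0 < ((1 + P) * v - (1 + Q)) / (1 + Q0) :=
        div_pos (not_le.1 h2) (by linarith)
      linarith
    · linarith
    · have : ((1 + P) * u - (1 + Q)) / (1 + Q0) < ((1 + P) * v - (1 + Q)) / (1 + Q0) :=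
        div_lt_div_of_pos_right (by linarith) (by linarith)
      linarith
  · intro u hu0
    dsimp only
    split_ifs with h1
    · rw [hτ1 u hu0 h1]
      exact div_pos (mul_pos (by linarith) hu0) (hr u hu0 h1)
    · have h4 : 0 < ((1 + P) * u - (1 + Q)) / (1 + Q0) :=
        div_pos (not_le.1 h1) (by linarith)
      linarith
  intro D _ A hA α β hα hβ hαβ e he hDel M yf hM hyf
  have hβ' : (β : ℝ) ≠ 0 := by exact_mod_cast hβ
  have hσ : 0 < (α : ℝ) / β := by
    have h1 : (0:ℝ) < α * β := by exact_mod_cast hαβ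
    have h2 : (α : ℝ) / β = α * β / (β * β) := by field_simp
    rw [h2]
    exact div_pos h1 (mul_self_pos.2 hβ')
  have hδ : (1 + P) * ((α : ℝ) / β) - (1 + Q) ≠ 0 := by
    intro h
    apply hDel
    have h2 : (1 + P) * (α : ℝ) - (1 + Q) * β = 0 := by
      field_simp at h
      linarith
    rw [hP, hQ] at h2
    simp only [ha, hb] at h2
    unfold Del
    exact_mod_cast h2
  have hiff := Lam_iff p q hpq D A hA α β hβ e he
  rw [← ha, ← hb] at hiff
  change ∀ x s : ℝ, 0 < x → 0 < s → (_ ↔ _ = _ - ((1 + ∑ i, a i) * ((α : ℝ) / β) -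
    (1 + ∑ i, b i)) * Real.log x) at hiff
  rw [← hP, ← hQ] at hiff
  have hcont := LL_cont a b ((α : ℝ) / β) hab
  have hzero := LL_zero a b ((α : ℝ) / β) hab
  have htop := LL_top a b ((α : ℝ) / β) hab
  rw [← hQ0] at hzero
  rw [← hQ, ← hP'] at htop
  generalize (α : ℝ) / β = σ at *
  obtain ⟨k, hk⟩ : ∃ k, k = D * Real.log A / β := ⟨_, rfl⟩
  rw [← hk] at hiff
  obtain ⟨δ, hδe⟩ : ∃ δ, δ = (1 + P) * σ - (1 + Q) := ⟨_, rfl⟩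
  have hrσ := hr σ hσ
  rw [← hδe] at hiff hδ hrσ
  have htp : ∀ x, 0 < x → x < M → 0 < (fun x => yf x / x) x := fun x hx hxM =>
    div_pos (hyf x hx hxM).1 hx
  have heq : ∀ x, 0 < x → x < M → LL a b σ (yf x / x) = k - δ * Real.log x := by
    intro x hx hxM
    rw [← hiff x _ hx (htp x hx hxM), mul_div_cancel₀ _ hx.ne']
    exact (hyf x hx hxM).2.1
  have hu : ∀ x, 0 < x → x < M → ∀ s, 0 < s → LL a b σ s = k - δ * Real.log x →
      s = (fun x => yf x / x) x := by
    intro x hx hxM s hs h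
    have := (hyf x hx hxM).2.2 (x * s) (mul_pos hx hs) ((hiff x s hx hs).2 h)
    simp only
    rw [← this]
    field_simp
  have hfin : ∀ r C : ℝ, Filter.Tendsto (fun x : ℝ => (fun x => yf x / x) x / x ^ (δ / r))
      (nhdsWithin 0 (Set.Ioi 0)) (nhds C) →
      Filter.Tendsto (fun x : ℝ => yf x / x ^ (1 + δ / r))
      (nhdsWithin 0 (Set.Ioi 0)) (nhds C) := by
    intro r C h
    refine h.congr' ?_
    filter_upwards [self_mem_nhdsWithin] with x hx
    have hx0 : 0 < x := hx
    rw [Real.rpow_add hx0, Real.rpow_one, div_div]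
  dsimp only
  rw [← hδe]
  rcases lt_or_gt_of_ne hδ with hneg | hpos
  · rw [if_pos hneg.le]
    obtain ⟨g, c, hg, hgL⟩ := htop
    have hr0 := hrσ hneg.le
    have hL : Filter.Tendsto (LL a b σ) Filter.atTop Filter.atBot := by
      have h1 := (Real.tendsto_log_atTop.const_mul_atTop_of_neg (neg_lt_zero.2 hr0)).atBot_add hg
      refine h1.congr' ?_
      filter_upwards [Filter.eventually_gt_atTop 0] with s hs
      exact (hgL s hs).symm
    have ht := root_to_top _ _ k δ M hM hneg hcont hL hu
    refine ⟨_, Real.exp_pos _, hfin _ _ (core_asymp _ g _ c k _ δ M hr0 hM hg ht htp ?_)⟩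
    intro x hx hxM
    rw [← hgL _ (htp x hx hxM)]
    exact heq x hx hxM
  · rw [if_neg (not_le.2 hpos)]
    obtain ⟨g, c, hg, hgL⟩ := hzero
    have hr0 : 0 < 1 + Q0 := by linarith
    have hL : Filter.Tendsto (LL a b σ) (nhdsWithin 0 (Set.Ioi 0)) Filter.atTop := by
      have h1 := (Real.tendsto_log_nhdsGT_zero.const_mul_atBot_of_neg
        (neg_lt_zero.2 hr0)).atTop_add hg
      refine h1.congr' ?_
      filter_upwards [self_mem_nhdsWithin] with s hs
      exact (hgL s hs).symm
    have ht := root_to_zero _ _ k δ M hM hpos hcont hL htp hu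
    refine ⟨_, Real.exp_pos _, hfin _ _ (core_asymp _ g _ c k _ δ M hr0 hM hg ht htp ?_)⟩
    intro x hx hxM
    rw [← hgL _ (htp x hx hxM)]
    exact heq x hx hxM

end LamSec
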